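/- arXiv:2407.20104 — 2 statements merged into one kernel-verified Lean document; each statement's English description precedes it below -/
import Mathlib

section
/- Let P : (0,∞) → ℝ be C² with P'(r) > 0 for all r > 0, let G : (0,∞) → ℝ be twice differentiable with G''(r) = P'(r)/r for all r > 0, and let 0 < m₀ ≤ M₀. Then there exist constants δ ∈ (0, m₀/2), J₀ > 0 and c > 0 such that for every ρ̄ ∈ [m₀, M₀], every σ ∈ ℝ with |σ| ≤ δ, every J̄ ∈ ℝ with |J̄| ≤ J₀, and every j ∈ ℝ, the relative energy is coercive: (ρ̄ j − J̄ σ)²/(2(ρ̄ + σ)ρ̄²) + G(ρ̄ + σ) − G(ρ̄) − G'(ρ̄)·σ ≥ c·(j² + σ²). -/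
open Set

/-- A function whose second derivative is at least `k` on a closed interval lies above its tangent
lines there by at least `k / 2` times the squared distance to the point of tangency. -/
theorem half_mul_sq_le_sub_tangent {G : ℝ → ℝ} {a b k x y : ℝ}
    (hG : ∀ r ∈ Icc a b, DifferentiableAt ℝ G r)
    (hG' : ∀ r ∈ Icc a b, DifferentiableAt ℝ (deriv G) r)
    (hk : ∀ r ∈ Icc a b, k ≤ deriv (deriv G) r)
    (hx : x ∈ Icc a b) (hy : y ∈ Icc a b) :
    k / 2 * (y - x) ^ 2 ≤ G y - G x - deriv G x * (y - x) := by
  have hd : ∀ r ∈ Icc a b,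
      HasDerivAt (fun t ↦ G t - k / 2 * t ^ 2) (deriv G r - k * r) r := by
    intro r hr
    exact ((hG r hr).hasDerivAt.sub (((hasDerivAt_id' r).pow 2).const_mul (k / 2))).congr_deriv
      (by norm_num; ring)
  have hd2 : ∀ r ∈ Icc a b,
      HasDerivAt (fun t ↦ deriv G t - k * t) (deriv (deriv G) r - k) r := by
    intro r hr
    exact ((hG' r hr).hasDerivAt.sub ((hasDerivAt_id' r).const_mul k)).congr_deriv (by ring)
  have hconv : ConvexOn ℝ (Icc a b) (fun t ↦ G t - k / 2 * t ^ 2) :=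
    convexOn_of_hasDerivWithinAt2_nonneg (convex_Icc a b)
      (fun r hr ↦ (hd r hr).continuousAt.continuousWithinAt)
      (fun r hr ↦ (hd r (interior_subset hr)).hasDerivWithinAt)
      (fun r hr ↦ (hd2 r (interior_subset hr)).hasDerivWithinAt)
      (fun r hr ↦ sub_nonneg.2 (hk r (interior_subset hr)))
  rcases lt_trichotomy x y with h | rfl | h
  · have hs := hconv.le_slope_of_hasDerivAt hx hy h (hd x hx)
    rw [slope_def_field, le_div_iff₀ (sub_pos.2 h)] at hs
    linarith
  · simp
  · have hs := hconv.slope_le_of_hasDerivAt hy hx h (hd x hx)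
    rw [slope_def_field, div_le_iff₀ (sub_pos.2 h)] at hs
    linarith

/-- Coercivity of the relative energy: for densities in a fixed compact range,
small density perturbations and small steady currents, the relative energy
dominates a multiple of `j² + σ²`. -/
theorem relative_energy_coercive
    (P G : ℝ → ℝ)
    (hP : ContDiffOn ℝ 2 P (Ioi 0))
    (hP' : ∀ r : ℝ, 0 < r → 0 < deriv P r)
    (hG : ∀ r : ℝ, 0 < r → DifferentiableAt ℝ G r)
    (hG' : ∀ r : ℝ, 0 < r → DifferentiableAt ℝ (deriv G) r)
    (hG'' : ∀ r : ℝ, 0 < r → deriv (deriv G) r = deriv P r / r)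
    (m₀ M₀ : ℝ) (hm₀ : 0 < m₀) (hmM : m₀ ≤ M₀) :
    ∃ δ : ℝ, 0 < δ ∧ δ < m₀ / 2 ∧ ∃ J₀ : ℝ, 0 < J₀ ∧ ∃ c : ℝ, 0 < c ∧
      ∀ ρ ∈ Icc m₀ M₀, ∀ σ : ℝ, |σ| ≤ δ → ∀ J : ℝ, |J| ≤ J₀ → ∀ j : ℝ,
        c * (j ^ 2 + σ ^ 2) ≤
          (ρ * j - J * σ) ^ 2 / (2 * (ρ + σ) * ρ ^ 2)
            + G (ρ + σ) - G ρ - deriv G ρ * σ := by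
  have hpos : ∀ r ∈ Icc (m₀ / 2) (M₀ + m₀), 0 < r := fun r hr ↦ (half_pos hm₀).trans_le hr.1
  have hcont : ContinuousOn (fun r ↦ deriv P r / r) (Icc (m₀ / 2) (M₀ + m₀)) :=
    ((hP.continuousOn_deriv_of_isOpen isOpen_Ioi (by norm_num)).mono hpos).div continuousOn_id
      fun r hr ↦ (hpos r hr).ne'
  obtain ⟨r₀, hr₀, hmin⟩ := isCompact_Icc.exists_isMinOn
    (nonempty_Icc.2 (by linarith : m₀ / 2 ≤ M₀ + m₀)) hcont
  obtain ⟨k, hk⟩ : ∃ k, k = deriv P r₀ / r₀ := ⟨_, rfl⟩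
  have hk0 : 0 < k := hk ▸ div_pos (hP' _ (hpos _ hr₀)) (hpos _ hr₀)
  have hB : 0 < M₀ + m₀ := by linarith
  refine ⟨m₀ / 4, by linarith, by linarith, √(k * m₀ ^ 3 / 4), by positivity,
    min (1 / (4 * (M₀ + m₀))) (k / 4), by positivity, ?_⟩
  rintro ρ ⟨hρ1, hρ2⟩ σ hσ J hJ j
  obtain ⟨hσ1, hσ2⟩ := abs_le.1 hσ
  have hρ : 0 < ρ := hm₀.trans_le hρ1
  have hs1 : m₀ / 2 ≤ ρ + σ := by linarith
  have hs2 : ρ + σ ≤ M₀ + m₀ := by linarith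
  have hs : 0 < ρ + σ := by linarith
  have hJ2 : J ^ 2 ≤ k * m₀ ^ 3 / 4 := by
    rw [← Real.sq_sqrt (by positivity : 0 ≤ k * m₀ ^ 3 / 4), ← sq_abs J]
    gcongr
  have htan : k / 2 * σ ^ 2 ≤ G (ρ + σ) - G ρ - deriv G ρ * σ := by
    have h := half_mul_sq_le_sub_tangent (G := G) (k := k) (x := ρ) (y := ρ + σ)
      (fun r hr ↦ hG r (hpos r hr)) (fun r hr ↦ hG' r (hpos r hr))
      (fun r hr ↦ by rw [hG'' r (hpos r hr), hk]; exact hmin hr)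
      ⟨by linarith, by linarith⟩ ⟨hs1, hs2⟩
    simpa using h
  have hkin : 1 / (4 * (M₀ + m₀)) * j ^ 2 - k / 4 * σ ^ 2 ≤
      (ρ * j - J * σ) ^ 2 / (2 * (ρ + σ) * ρ ^ 2) := by
    have hden : m₀ ^ 3 ≤ 2 * (ρ + σ) * ρ ^ 2 := calc
      m₀ ^ 3 = 2 * (m₀ / 2) * m₀ ^ 2 := by ring
      _ ≤ 2 * (ρ + σ) * ρ ^ 2 := by gcongr
    have h1 : 1 / (4 * (M₀ + m₀)) * j ^ 2 ≤ ρ ^ 2 * j ^ 2 / 2 / (2 * (ρ + σ) * ρ ^ 2) := calc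
      1 / (4 * (M₀ + m₀)) * j ^ 2 ≤ 1 / (4 * (ρ + σ)) * j ^ 2 := by gcongr
      _ = ρ ^ 2 * j ^ 2 / 2 / (2 * (ρ + σ) * ρ ^ 2) := by field_simp; ring
    have h2 : J ^ 2 * σ ^ 2 / (2 * (ρ + σ) * ρ ^ 2) ≤ k / 4 * σ ^ 2 := calc
      J ^ 2 * σ ^ 2 / (2 * (ρ + σ) * ρ ^ 2) ≤ k * m₀ ^ 3 / 4 * σ ^ 2 / m₀ ^ 3 := by gcongr
      _ = k / 4 * σ ^ 2 := by field_simp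
    have h3 : (ρ ^ 2 * j ^ 2 / 2 - J ^ 2 * σ ^ 2) / (2 * (ρ + σ) * ρ ^ 2) ≤
        (ρ * j - J * σ) ^ 2 / (2 * (ρ + σ) * ρ ^ 2) := by
      gcongr
      nlinarith [sq_nonneg (ρ * j - 2 * (J * σ))]
    rw [sub_div] at h3
    linarith
  have hc1 := mul_le_mul_of_nonneg_right
    (min_le_left (1 / (4 * (M₀ + m₀))) (k / 4)) (sq_nonneg j)
  have hc2 := mul_le_mul_of_nonneg_right
    (min_le_right (1 / (4 * (M₀ + m₀))) (k / 4)) (sq_nonneg σ)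
  linarith
end

section
/- Let (Ω, 𝔉, ℙ) be a probability space, let B ≥ 0, and for each t > 0 let Z_t : Ω → ℝ be a random variable with |Z_t| ≤ B almost surely, such that t ↦ 𝔼[Z_t] is measurable. Suppose there exist a constant C ≥ 0, a real γ > 0, and an integer m ≥ 1 such that 𝔼[|Z_t|^{2m}] ≤ C·tᵐ·e^{−γ m t} for all t > 0. Then lim_{T→∞} (1/T)·∫₀ᵀ 𝔼[Z_t] dt = 0. -/
open MeasureTheory

open Filter Topology in
/-- The Cesàro averages of a bounded measurable function on `(0, ∞)` converge to its limit at
infinity. -/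
theorem tendsto_cesaro_intervalIntegral {f : ℝ → ℝ} {B l : ℝ} (hf : Measurable f)
    (hB : ∀ t, 0 < t → |f t| ≤ B) (hl : Tendsto f atTop (𝓝 l)) :
    Tendsto (fun T : ℝ => (1 / T) * ∫ t in (0 : ℝ)..T, f t) atTop (𝓝 l) := by
  have key : Tendsto (fun T : ℝ => ∫ s in (0 : ℝ)..1, f (T * s)) atTop
      (𝓝 (∫ _ in (0 : ℝ)..1, l)) := by
    refine intervalIntegral.tendsto_integral_filter_of_dominated_convergence (fun _ => B)
      (.of_forall fun T => (hf.comp (measurable_const_mul T)).aestronglyMeasurable) ?_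
      intervalIntegrable_const (.of_forall fun s hs => ?_)
    · filter_upwards [eventually_gt_atTop 0] with T hT
      refine .of_forall fun s hs => ?_
      rw [Set.uIoc_of_le zero_le_one] at hs
      exact hB _ (mul_pos hT hs.1)
    · rw [Set.uIoc_of_le zero_le_one] at hs
      exact hl.comp (tendsto_id.atTop_mul_const hs.1)
  rw [intervalIntegral.integral_const, sub_zero, one_smul] at key
  refine key.congr' ?_
  filter_upwards [eventually_gt_atTop 0] with T hT
  rw [intervalIntegral.integral_comp_mul_left f hT.ne']
  simp

/-- Jensen's inequality for even powers of a bounded random variable. -/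
theorem abs_integral_pow_le_integral_abs_pow {Ω : Type*} [MeasurableSpace Ω] {μ : Measure Ω}
    [IsProbabilityMeasure μ] {X : Ω → ℝ} {B : ℝ} (hX : AEStronglyMeasurable X μ)
    (hB : ∀ᵐ ω ∂μ, |X ω| ≤ B) {n : ℕ} (hn : Even n) :
    |∫ ω, X ω ∂μ| ^ n ≤ ∫ ω, |X ω| ^ n ∂μ := by
  simp only [hn.pow_abs]
  refine hn.convexOn_pow.map_integral_le (continuous_pow n).continuousOn isClosed_univ
    (.of_forall fun _ => Set.mem_univ _) (.of_bound hX B hB)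
    (.of_bound (hX.pow n) (B ^ n) ?_)
  filter_upwards [hB] with ω hω
  simpa using pow_le_pow_left₀ (abs_nonneg _) hω n

open Filter Topology in
theorem tendsto_pow_mul_exp_neg_mul_atTop_nhds_zero (m : ℕ) {b : ℝ} (hb : 0 < b) :
    Tendsto (fun t : ℝ => t ^ m * Real.exp (-b * t)) atTop (𝓝 0) := by
  simpa using tendsto_rpow_mul_exp_neg_mul_atTop_nhds_zero m b hb

/-- If the random variables `Z t` are uniformly bounded and have exponentially
decaying `2m`-th moments, then the Cesàro averages of their expectations tend
to zero. -/
theorem cesaro_expectation_tendsto_zero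
    {Ω : Type*} [MeasurableSpace Ω] (μ : Measure Ω) [IsProbabilityMeasure μ]
    (Z : ℝ → Ω → ℝ) (B : ℝ) (hB : 0 ≤ B)
    (hZmeas : ∀ t : ℝ, 0 < t → Measurable (Z t))
    (hZbdd : ∀ t : ℝ, 0 < t → ∀ᵐ ω ∂μ, |Z t ω| ≤ B)
    (hEmeas : Measurable fun t => ∫ ω, Z t ω ∂μ)
    (C : ℝ) (hC : 0 ≤ C) (γ : ℝ) (hγ : 0 < γ) (m : ℕ) (hm : 1 ≤ m)
    (hmom : ∀ t : ℝ, 0 < t →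
      (∫ ω, |Z t ω| ^ (2 * m) ∂μ) ≤ C * t ^ m * Real.exp (-γ * (m : ℝ) * t)) :
    Filter.Tendsto
      (fun T : ℝ => (1 / T) * ∫ t in (0:ℝ)..T, ∫ ω, Z t ω ∂μ)
      Filter.atTop (nhds 0) := by
  have hlim : Filter.Tendsto (fun t => |∫ ω, Z t ω ∂μ| ^ (2 * m)) Filter.atTop (nhds 0) := by
    have hbound := (tendsto_pow_mul_exp_neg_mul_atTop_nhds_zero m
      (mul_pos hγ (Nat.cast_pos.2 hm : (0 : ℝ) < m))).const_mul C
    rw [mul_zero] at hbound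
    refine squeeze_zero' (.of_forall fun t => by positivity) ?_ hbound
    filter_upwards [Filter.eventually_gt_atTop 0] with t ht
    refine (abs_integral_pow_le_integral_abs_pow (hZmeas t ht).aestronglyMeasurable
      (hZbdd t ht) (even_two_mul m)).trans ((hmom t ht).trans_eq ?_)
    rw [mul_assoc, neg_mul]
  have hexp : Filter.Tendsto (fun t => ∫ ω, Z t ω ∂μ) Filter.atTop (nhds 0) := by
    rw [Metric.tendsto_nhds]
    intro ε hε
    filter_upwards [hlim.eventually_lt_const (pow_pos hε (2 * m))] with t ht
    rw [Real.dist_0_eq_abs]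
    exact lt_of_pow_lt_pow_left₀ _ hε.le ht
  refine tendsto_cesaro_intervalIntegral (B := B) hEmeas (fun t ht => ?_) hexp
  simpa using norm_integral_le_of_norm_le_const (f := Z t) (hZbdd t ht)
end
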